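/- Let κ, q, c, η, T, σ be real numbers with κ > 0, q > 0, c > 0, η ≥ q², T > 0, set Δ = (κ+q)² + η − q², let Q(t) = −(1/2)[κ + q − √Δ ( √Δ sinh(√Δ(T−t)) + (κ+q+c) cosh(√Δ(T−t)) ) / ( √Δ cosh(√Δ(T−t)) + (κ+q+c) sinh(√Δ(T−t)) )], and define w(t,θ) = Q(t)·θ + σ²∫ₜᵀ Q(s) ds. Then w(T,θ) = (c/2)θ for all θ, and for every t ∈ [0,T] and every θ ≥ 0: (i) the infimum over φ ∈ ℝ of (−2(κ+φ)θ + σ²)·∂_θ w(t,θ) + ((1/2)φ² − qφ + η/2)·θ equals −2κ Q(t) θ + σ² Q(t) − (1/2)(q + 2Q(t))² θ + (η/2)θ, attained at φ = q + 2Q(t) (and this is the unique minimizer when θ > 0); and (ii) ∂ₜ w(t,θ) plus this infimum equals 0. -/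

import Mathlib

/-- The explicit Riccati function of the systemic risk LQ McKean-Vlasov control problem. -/
noncomputable def Qsys (κ q c η T : ℝ) (t : ℝ) : ℝ :=
  -(1/2) * (κ + q - Real.sqrt ((κ + q)^2 + η - q^2) *
    (Real.sqrt ((κ + q)^2 + η - q^2) * Real.sinh (Real.sqrt ((κ + q)^2 + η - q^2) * (T - t))
      + (κ + q + c) * Real.cosh (Real.sqrt ((κ + q)^2 + η - q^2) * (T - t))) /
    (Real.sqrt ((κ + q)^2 + η - q^2) * Real.cosh (Real.sqrt ((κ + q)^2 + η - q^2) * (T - t))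
      + (κ + q + c) * Real.sinh (Real.sqrt ((κ + q)^2 + η - q^2) * (T - t))))

/-- Candidate value function of the reduced problem in the variance variable. -/
noncomputable def wsys (κ q c η T σ : ℝ) (t θ : ℝ) : ℝ :=
  Qsys κ q c η T t * θ + σ^2 * ∫ s in t..T, Qsys κ q c η T s

theorem mul_cosh_add_mul_sinh_pos {s a x : ℝ} (hs : 0 < s) (ha : 0 ≤ a) (hx : 0 ≤ x) :
    0 < s * Real.cosh x + a * Real.sinh x :=
  add_pos_of_pos_of_nonneg (mul_pos hs (Real.cosh_pos x))
    (mul_nonneg ha (Real.sinh_nonneg_iff.2 hx))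

theorem hasDerivAt_sinh_cosh_quotient {s a T t : ℝ}
    (hD : s * Real.cosh (s * (T - t)) + a * Real.sinh (s * (T - t)) ≠ 0) :
    HasDerivAt (fun u => (s * Real.sinh (s * (T - u)) + a * Real.cosh (s * (T - u))) /
        (s * Real.cosh (s * (T - u)) + a * Real.sinh (s * (T - u))))
      (s * (((s * Real.sinh (s * (T - t)) + a * Real.cosh (s * (T - t))) /
        (s * Real.cosh (s * (T - t)) + a * Real.sinh (s * (T - t)))) ^ 2 - 1)) t := by
  have hx : HasDerivAt (fun u => s * (T - u)) (s * (-1)) t :=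
    ((hasDerivAt_id t).const_sub T).const_mul s
  refine (((hx.sinh.const_mul s).add (hx.cosh.const_mul a)).div
    ((hx.cosh.const_mul s).add (hx.sinh.const_mul a)) hD).congr_deriv ?_
  simp only [Pi.add_apply]
  field_simp
  ring

/-- `Qsys` solves its Riccati equation on `(-∞, T]`. -/
theorem hasDerivAt_Qsys {κ q c η T t : ℝ} (hκ : 0 < κ) (hq : 0 < q) (hc : 0 < c)
    (hη : q ^ 2 ≤ η) (ht : t ≤ T) :
    HasDerivAt (Qsys κ q c η T)
      (2 * κ * Qsys κ q c η T t + (1/2) * (q + 2 * Qsys κ q c η T t) ^ 2 - η/2) t := by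
  have hΔ : 0 < (κ + q) ^ 2 + η - q ^ 2 := by
    have : 0 < (κ + q) ^ 2 := by positivity
    linarith
  have hs := Real.sqrt_pos.2 hΔ
  have hs2 := Real.sq_sqrt hΔ.le
  unfold Qsys
  generalize √((κ + q) ^ 2 + η - q ^ 2) = s at hs hs2 ⊢
  have hD := mul_cosh_add_mul_sinh_pos hs (by positivity : 0 ≤ κ + q + c)
    (mul_nonneg hs.le (sub_nonneg.2 ht))
  have hY := hasDerivAt_sinh_cosh_quotient hD.ne'
  have h := ((hY.const_mul s).const_sub (κ + q)).const_mul (-(1/2))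
  simp only [mul_div_assoc]
  refine h.congr_deriv ?_
  generalize (s * Real.sinh (s * (T - t)) + (κ + q + c) * Real.cosh (s * (T - t))) /
    (s * Real.cosh (s * (T - t)) + (κ + q + c) * Real.sinh (s * (T - t))) = Y
  linear_combination (-(1/2)) * hs2

theorem Qsys_terminal {κ q c η T : ℝ} (hκ : 0 < κ) (hq : 0 < q) (hη : q ^ 2 ≤ η) :
    Qsys κ q c η T T = c / 2 := by
  have hΔ : 0 < (κ + q) ^ 2 + η - q ^ 2 := by
    have : 0 < (κ + q) ^ 2 := by positivity
    linarith
  have hs := (Real.sqrt_pos.2 hΔ).ne'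
  simp only [Qsys, sub_self, mul_zero, Real.sinh_zero, Real.cosh_zero, mul_one, add_zero, zero_add]
  rw [mul_div_cancel_left₀ _ hs]
  ring

theorem measurable_Qsys (κ q c η T : ℝ) : Measurable (Qsys κ q c η T) := by
  unfold Qsys
  fun_prop

theorem hasDerivAt_wsys_variance (κ q c η T σ t θ : ℝ) :
    HasDerivAt (fun θ' => wsys κ q c η T σ t θ') (Qsys κ q c η T t) θ := by
  simpa [wsys] using ((hasDerivAt_id θ).const_mul (Qsys κ q c η T t)).add_const
    (σ ^ 2 * ∫ s in t..T, Qsys κ q c η T s)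

theorem hasDerivAt_wsys_time {κ q c η T t : ℝ} (hκ : 0 < κ) (hq : 0 < q) (hc : 0 < c)
    (hη : q ^ 2 ≤ η) (ht : t ≤ T) (σ θ : ℝ) :
    HasDerivAt (fun t' => wsys κ q c η T σ t' θ)
      ((2 * κ * Qsys κ q c η T t + (1/2) * (q + 2 * Qsys κ q c η T t) ^ 2 - η/2) * θ
        + σ ^ 2 * -Qsys κ q c η T t) t := by
  have hQ := hasDerivAt_Qsys hκ hq hc hη ht
  have hint : IntervalIntegrable (Qsys κ q c η T) MeasureTheory.volume t T := by
    refine ContinuousOn.intervalIntegrable fun s hs => ?_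
    rw [Set.uIcc_of_le ht] at hs
    exact (hasDerivAt_Qsys hκ hq hc hη hs.2).continuousAt.continuousWithinAt
  exact (hQ.mul_const θ).add ((intervalIntegral.integral_hasDerivAt_left hint
    (measurable_Qsys κ q c η T).stronglyMeasurable.stronglyMeasurableAtFilter
    hQ.continuousAt).const_mul (σ ^ 2))

theorem stmt5 (κ q c η T σ : ℝ) (hκ : 0 < κ) (hq : 0 < q) (hc : 0 < c)
    (hη : q^2 ≤ η) (hT : 0 < T) :
    (∀ θ : ℝ, wsys κ q c η T σ T θ = (c/2) * θ) ∧
    ∀ t ∈ Set.Icc (0:ℝ) T, ∀ θ : ℝ, 0 ≤ θ →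
      (IsLeast
        (Set.range (fun φ : ℝ =>
          (-2 * (κ + φ) * θ + σ^2) * deriv (fun θ' => wsys κ q c η T σ t θ') θ
            + ((1/2) * φ^2 - q * φ + η/2) * θ))
        (-2 * κ * Qsys κ q c η T t * θ + σ^2 * Qsys κ q c η T t
          - (1/2) * (q + 2 * Qsys κ q c η T t)^2 * θ + (η/2) * θ)) ∧
      ((fun φ : ℝ =>
          (-2 * (κ + φ) * θ + σ^2) * deriv (fun θ' => wsys κ q c η T σ t θ') θ
            + ((1/2) * φ^2 - q * φ + η/2) * θ) (q + 2 * Qsys κ q c η T t)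
        = -2 * κ * Qsys κ q c η T t * θ + σ^2 * Qsys κ q c η T t
          - (1/2) * (q + 2 * Qsys κ q c η T t)^2 * θ + (η/2) * θ) ∧
      (0 < θ → ∀ φ : ℝ,
        (-2 * (κ + φ) * θ + σ^2) * deriv (fun θ' => wsys κ q c η T σ t θ') θ
            + ((1/2) * φ^2 - q * φ + η/2) * θ
          = -2 * κ * Qsys κ q c η T t * θ + σ^2 * Qsys κ q c η T t
            - (1/2) * (q + 2 * Qsys κ q c η T t)^2 * θ + (η/2) * θ →
        φ = q + 2 * Qsys κ q c η T t) ∧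
      (deriv (fun t' => wsys κ q c η T σ t' θ) t
        + (-2 * κ * Qsys κ q c η T t * θ + σ^2 * Qsys κ q c η T t
            - (1/2) * (q + 2 * Qsys κ q c η T t)^2 * θ + (η/2) * θ) = 0) := by
  refine ⟨fun θ => by simp [wsys, Qsys_terminal hκ hq hη], fun t ht θ hθ => ?_⟩
  simp only [(hasDerivAt_wsys_variance κ q c η T σ t θ).deriv,
    (hasDerivAt_wsys_time hκ hq hc hη ht.2 σ θ).deriv]
  generalize Qsys κ q c η T t = Q
  refine ⟨⟨⟨q + 2 * Q, by ring⟩, ?_⟩, by ring, fun hθ' φ h => ?_, by ring⟩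
  · rintro _ ⟨φ, rfl⟩
    linarith [mul_nonneg hθ (sq_nonneg (φ - (q + 2 * Q)))]
  · have h0 : θ * (φ - (q + 2 * Q)) ^ 2 = 0 := by linear_combination 2 * h
    exact sub_eq_zero.1 (pow_eq_zero_iff two_ne_zero |>.1
      ((mul_eq_zero.1 h0).resolve_left hθ'.ne'))
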